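/- arXiv:2501.02605 — 5 statements merged into one kernel-verified Lean document; each statement's English description precedes it below -/
import Mathlib

section
/- There exists a constant C > 0, depending only on N and Ω, such that for every Radon measure τ on Ω∖{0} with ∫_{Ω∖{0}} φ d|τ| < ∞ one has ‖𝔽̃[φ τ]‖_{L^{(N+1)/N}_w(Ω∖{0}; φ)} ≤ C ∫_{Ω∖{0}} φ d|τ|, where φ(x) = |x|^{−(N−2)/2} d(x). -/
open MeasureTheory Metric Set

noncomputable section

/-- `ℝ^N` with the Euclidean metric. -/
abbrev Euc (N : ℕ) : Type := EuclideanSpace ℝ (Fin N)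

/-- Distance `d(x)` to the boundary of `Ω`. -/
def bdist {N : ℕ} (Ω : Set (Euc N)) (x : Euc N) : ℝ := infDist x (frontier Ω)

/-- Distance `d_Σ(x)` to the set `Sg`. -/
def sdist {N : ℕ} (Sg : Set (Euc N)) (x : Euc N) : ℝ := infDist x Sg

/-- The weight `φ_α(x) = d_Σ(x) ^ (−α) * d(x)`. -/
def phiw {N : ℕ} (Ω Sg : Set (Euc N)) (α : ℝ) (x : Euc N) : ℝ :=
  sdist Sg x ^ (-α) * bdist Ω x

/-- The logarithmic kernel `F̃(x,y)` (case `Σ = {0}`, `μ = ((N−2)/2)²`). -/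
def Ftil {N : ℕ} (Ω : Set (Euc N)) (x y : Euc N) : ℝ :=
  dist x (0 : Euc N) ^ (-((N : ℝ) - 2) / 2) * (bdist Ω y)⁻¹ *
    |Real.log (min 1 (dist x y ^ 2 / (bdist Ω x * bdist Ω y)))|

/-- Schur-type bound: a uniform bound on the kernel integrated in the first variable passes to the
integral operator acting on a weighted measure of finite mass. -/
lemma lintegral_lintegral_mul_mul_le {X Y : Type*} [MeasurableSpace X] [MeasurableSpace Y]
    {μ : Measure X} [SFinite μ] {τ : Measure Y} {F : X → Y → ENNReal}
    (hF : Measurable (Function.uncurry F)) {w : Y → ENNReal} (hw : Measurable w)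
    (hwτ : ∫⁻ y, w y ∂τ ≠ ⊤) {φ : X → ENNReal} (hφ : Measurable φ) {M : ENNReal}
    (hM : ∀ y, ∫⁻ x, F x y * φ x ∂μ ≤ M) :
    ∫⁻ x, (∫⁻ y, F x y * w y ∂τ) * φ x ∂μ ≤ M * ∫⁻ y, w y ∂τ := by
  have : IsFiniteMeasure (τ.withDensity w) := isFiniteMeasure_withDensity hwτ
  have hFx : ∀ x, Measurable (F x) := fun x => hF.comp measurable_prodMk_left
  have hinner : ∀ x, ∫⁻ y, F x y * w y ∂τ = ∫⁻ y, F x y ∂(τ.withDensity w) := fun x => by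
    rw [lintegral_withDensity_eq_lintegral_mul _ hw (hFx x)]
    simp only [Pi.mul_apply, mul_comm]
  calc ∫⁻ x, (∫⁻ y, F x y * w y ∂τ) * φ x ∂μ
      = ∫⁻ x, ∫⁻ y, F x y * φ x ∂(τ.withDensity w) ∂μ := by
        refine lintegral_congr fun x => ?_
        rw [hinner, lintegral_mul_const _ (hFx x)]
    _ = ∫⁻ y, ∫⁻ x, F x y * φ x ∂μ ∂(τ.withDensity w) :=
        lintegral_lintegral_swap (hF.mul (hφ.comp measurable_fst)).aemeasurable
    _ ≤ ∫⁻ _, M ∂(τ.withDensity w) := lintegral_mono hM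
    _ = M * ∫⁻ y, w y ∂τ := by
        rw [lintegral_const, withDensity_apply _ MeasurableSet.univ, Measure.restrict_univ]

lemma mul_inv_mul_abs_log_min_le {a b v p : ℝ} (ha : 0 ≤ a) (hb : 0 ≤ b) (hv : 0 ≤ v)
    (hab : a ≤ b + v) (hp : 0 < p) (hp1 : p ≤ 1) :
    a * b⁻¹ * |Real.log (min 1 (v ^ 2 / (a * b)))| ≤ 6 / p * (a ^ p * v ^ (-p)) := by
  have hR : 0 ≤ 6 / p * (a ^ p * v ^ (-p)) := by positivity
  rcases ha.eq_or_lt with rfl | ha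
  · simpa using hR
  rcases hb.eq_or_lt with rfl | hb
  · simpa using hR
  rcases hv.eq_or_lt with rfl | hv
  · simpa using hR
  rcases le_or_gt (a * b) (v ^ 2) with h | h
  · rw [min_eq_left ((one_le_div (by positivity)).2 h)]
    simpa using hR
  have hlt : v ^ 2 / (a * b) < 1 := (div_lt_one (by positivity)).2 h
  have ht3 : a / b ≤ 3 := by
    rw [div_le_iff₀ hb]
    by_contra! hc
    nlinarith [mul_self_le_mul_self (by linarith : 0 ≤ a - b) (by linarith : a - b ≤ v)]
  have ht : 0 < a / b := by positivity
  rw [min_eq_right hlt.le, abs_of_nonpos (Real.log_nonpos (by positivity) hlt.le), ← Real.log_inv]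
  have hlog := Real.log_le_rpow_div (x := (v ^ 2 / (a * b))⁻¹) (ε := p / 2) (by positivity)
    (by positivity)
  have hsplit : (v ^ 2 / (a * b))⁻¹ = (a ^ 2 * (v⁻¹) ^ 2) * (a / b)⁻¹ := by field_simp
  have hpow : ((v ^ 2 / (a * b))⁻¹) ^ (p / 2) = a ^ p * v ^ (-p) * (a / b) ^ (-(p / 2)) := by
    rw [hsplit, Real.mul_rpow (by positivity) (by positivity),
      Real.mul_rpow (by positivity) (by positivity), Real.inv_rpow ht.le, ← Real.rpow_neg ht.le,
      ← Real.rpow_natCast, ← Real.rpow_natCast, ← Real.rpow_mul ha.le,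
      ← Real.rpow_mul (by positivity), Real.inv_rpow hv.le, ← Real.rpow_neg hv.le,
      show ((2 : ℕ) : ℝ) * (p / 2) = p by push_cast; ring]
  have ht' : a / b * (a / b) ^ (-(p / 2)) ≤ 3 := by
    calc a / b * (a / b) ^ (-(p / 2)) = (a / b) ^ (1 - p / 2) := by
          rw [sub_eq_add_neg, Real.rpow_add ht, Real.rpow_one]
      _ ≤ 3 ^ (1 - p / 2) := Real.rpow_le_rpow ht.le ht3 (by linarith)
      _ ≤ 3 ^ (1 : ℝ) := Real.rpow_le_rpow_of_exponent_le (by norm_num) (by linarith)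
      _ = 3 := Real.rpow_one 3
  calc a * b⁻¹ * Real.log (v ^ 2 / (a * b))⁻¹
      ≤ a * b⁻¹ * (((v ^ 2 / (a * b))⁻¹) ^ (p / 2) / (p / 2)) := by gcongr
    _ = 2 / p * (a ^ p * v ^ (-p)) * (a / b * (a / b) ^ (-(p / 2))) := by
        rw [hpow]; field_simp
    _ ≤ 2 / p * (a ^ p * v ^ (-p)) * 3 := by gcongr
    _ = 6 / p * (a ^ p * v ^ (-p)) := by ring

lemma rpow_neg_mul_rpow_neg_le {u v α p s r : ℝ} (hu : 0 < u) (hv : 0 < v) (hα : 0 ≤ α)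
    (hp : 0 ≤ p) (hr : 0 ≤ r) (h : α + p = s * r) :
    u ^ (-α) * v ^ (-p) ≤ (u ^ (-s) + v ^ (-s)) ^ r := by
  have key : ∀ w : ℝ, 0 < w → w ^ (-α) * w ^ (-p) = (w ^ (-s)) ^ r := fun w hw => by
    rw [← Real.rpow_add hw, ← Real.rpow_mul hw.le]
    congr 1
    linarith
  rcases le_total u v with huv | huv
  · calc u ^ (-α) * v ^ (-p) ≤ u ^ (-α) * u ^ (-p) := by
          gcongr ?_ * ?_
          exact Real.rpow_le_rpow_of_nonpos hu huv (by linarith)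
      _ = (u ^ (-s)) ^ r := key u hu
      _ ≤ _ := by
          gcongr
          linarith [Real.rpow_nonneg hv.le (-s)]
  · calc u ^ (-α) * v ^ (-p) ≤ v ^ (-α) * v ^ (-p) := by
          gcongr ?_ * ?_
          exact Real.rpow_le_rpow_of_nonpos hv huv (by linarith)
      _ = (v ^ (-s)) ^ r := key v hv
      _ ≤ _ := by
          gcongr
          linarith [Real.rpow_nonneg hu.le (-s)]

lemma Ftil_mul_phiw_le {N : ℕ} (hN : 3 ≤ N) (Ω : Set (Euc N)) {x : Euc N} (hx : x ≠ 0)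
    (y : Euc N) :
    Ftil Ω x y * phiw Ω {(0 : Euc N)} (((N : ℝ) - 2) / 2) x ≤
      6 * (N + 1) * (phiw Ω {(0 : Euc N)} (((N : ℝ) - 2) / 2) x ^ (1 / ((N : ℝ) + 1)) *
        (dist x 0 ^ (-((N : ℝ) - 3 / 2)) + dist x y ^ (-((N : ℝ) - 3 / 2))) ^
          ((N : ℝ) / (N + 1))) := by
  have hN' : (3 : ℝ) ≤ N := by exact_mod_cast hN
  have hu : 0 < dist x 0 := dist_pos.2 hx
  have hv : 0 ≤ dist x y := dist_nonneg
  have ha : 0 ≤ bdist Ω x := infDist_nonneg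
  have hb : 0 ≤ bdist Ω y := infDist_nonneg
  have hab : bdist Ω x ≤ bdist Ω y + dist x y := infDist_le_infDist_add_dist
  simp only [Ftil, phiw, sdist, infDist_singleton]
  generalize bdist Ω x = a at *
  generalize bdist Ω y = b at *
  rcases hv.eq_or_lt with hv | hv
  · rw [← hv]
    simp only [ne_eq, OfNat.ofNat_ne_zero, not_false_eq_true, zero_pow, zero_div, zero_le_one,
      inf_of_le_right, Real.log_zero, abs_zero, mul_zero, zero_mul]
    positivity
  generalize dist x 0 = u at *
  generalize dist x y = v at *
  set n : ℝ := (N : ℝ)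
  have hlog := mul_inv_mul_abs_log_min_le (p := 1 / (n + 1)) ha hb hv.le hab (by positivity)
    ((div_le_one (by positivity)).2 (by linarith))
  have hα : 0 ≤ (n - 2) * (2 * n + 1) / (2 * (n + 1)) := by
    have : 0 ≤ n - 2 := by linarith
    positivity
  have hker := rpow_neg_mul_rpow_neg_le (s := n - 3 / 2) (r := n / (n + 1)) (p := 1 / (n + 1))
    hu hv hα (by positivity) (by positivity) (by field_simp; ring)
  have hpow : u ^ (-(n - 2) / 2) * u ^ (-((n - 2) / 2)) =
      (u ^ (-((n - 2) / 2))) ^ (1 / (n + 1)) * u ^ (-((n - 2) * (2 * n + 1) / (2 * (n + 1)))) := by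
    rw [← Real.rpow_mul hu.le, ← Real.rpow_add hu, ← Real.rpow_add hu]
    congr 1
    field_simp
    ring
  calc u ^ (-(n - 2) / 2) * b⁻¹ * |Real.log (min 1 (v ^ 2 / (a * b)))| *
        (u ^ (-((n - 2) / 2)) * a)
      = (u ^ (-(n - 2) / 2) * u ^ (-((n - 2) / 2))) *
        (a * b⁻¹ * |Real.log (min 1 (v ^ 2 / (a * b)))|) := by ring
    _ ≤ (u ^ (-(n - 2) / 2) * u ^ (-((n - 2) / 2))) *
        (6 / (1 / (n + 1)) * (a ^ (1 / (n + 1)) * v ^ (-(1 / (n + 1))))) := by gcongr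
    _ = 6 * (n + 1) * ((u ^ (-((n - 2) / 2)) * a) ^ (1 / (n + 1)) *
        (u ^ (-((n - 2) * (2 * n + 1) / (2 * (n + 1)))) * v ^ (-(1 / (n + 1))))) := by
        rw [hpow, Real.mul_rpow (by positivity) ha, div_div_eq_mul_div, div_one]
        ring
    _ ≤ _ := by gcongr

lemma measurable_phiw {N : ℕ} (Ω Sg : Set (Euc N)) (α : ℝ) : Measurable (phiw Ω Sg α) := by
  unfold phiw sdist bdist
  fun_prop

lemma measurable_Ftil {N : ℕ} (Ω : Set (Euc N)) :
    Measurable fun z : Euc N × Euc N => Ftil Ω z.1 z.2 := by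
  unfold Ftil bdist
  fun_prop

lemma Ftil_nonneg {N : ℕ} (Ω : Set (Euc N)) (x y : Euc N) : 0 ≤ Ftil Ω x y := by
  have : 0 ≤ bdist Ω y := infDist_nonneg
  unfold Ftil
  positivity

lemma phiw_nonneg {N : ℕ} (Ω Sg : Set (Euc N)) (α : ℝ) (x : Euc N) : 0 ≤ phiw Ω Sg α x :=
  mul_nonneg (Real.rpow_nonneg infDist_nonneg _) infDist_nonneg

lemma lintegral_ball_dist_rpow_lt_top {N : ℕ} (hN : 1 ≤ N) {s : ℝ} (hs : s < N) :
    ∫⁻ x in ball (0 : Euc N) 1, ENNReal.ofReal (dist x 0 ^ (-s)) < ⊤ := by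
  have hint : IntegrableOn (fun x : Euc N => dist x 0 ^ (-s)) (ball 0 1) := by
    refine integrableOn_ball_of_norm_le_rpow (C := 1) (α := s) (by simpa using hN)
      (by simpa using hs) (ae_of_all _ fun x => ?_)
      (Measurable.aestronglyMeasurable (by fun_prop))
    rw [dist_zero_right, one_mul, Real.norm_of_nonneg (by positivity)]
  exact hint.lintegral_lt_top

/-- Away from the unit ball the singular power is at most one. -/
lemma setLIntegral_dist_rpow_le {N : ℕ} {s : ℝ} (hs : 0 ≤ s) (A : Set (Euc N)) (y : Euc N) :
    ∫⁻ x in A, ENNReal.ofReal (dist x y ^ (-s)) ≤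
      (∫⁻ x in ball (0 : Euc N) 1, ENNReal.ofReal (dist x 0 ^ (-s))) + volume A := by
  have hpt : ∀ x : Euc N, ENNReal.ofReal (dist x y ^ (-s)) ≤
      (ball (0 : Euc N) 1).indicator (fun z => ENNReal.ofReal (dist z 0 ^ (-s))) (x - y) + 1 := by
    intro x
    by_cases hx : x - y ∈ ball (0 : Euc N) 1
    · rw [indicator_of_mem hx, dist_eq_norm, dist_zero_right]
      exact le_self_add
    · rw [indicator_of_notMem hx, zero_add, ← ENNReal.ofReal_one]
      rw [mem_ball_zero_iff, not_lt, ← dist_eq_norm] at hx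
      exact ENNReal.ofReal_le_ofReal (Real.rpow_le_one_of_one_le_of_nonpos hx (by linarith))
  calc ∫⁻ x in A, ENNReal.ofReal (dist x y ^ (-s))
      ≤ ∫⁻ x in A, ((ball (0 : Euc N) 1).indicator
          (fun z => ENNReal.ofReal (dist z 0 ^ (-s))) (x - y) + 1) := lintegral_mono hpt
    _ = (∫⁻ x in A, (ball (0 : Euc N) 1).indicator
          (fun z => ENNReal.ofReal (dist z 0 ^ (-s))) (x - y)) + volume A := by
        rw [lintegral_add_right _ measurable_const, setLIntegral_one]
    _ ≤ (∫⁻ x, (ball (0 : Euc N) 1).indicator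
          (fun z => ENNReal.ofReal (dist z 0 ^ (-s))) (x - y)) + volume A := by
        gcongr
        exact Measure.restrict_le_self
    _ = _ := by
        rw [lintegral_sub_right_eq_self, lintegral_indicator measurableSet_ball]

lemma setLIntegral_Ftil_mul_phiw_le {N : ℕ} (hN : 3 ≤ N) (Ω : Set (Euc N)) {A : Set (Euc N)}
    (hA : MeasurableSet A) (hAΩ : A ⊆ Ω \ {(0 : Euc N)}) (y : Euc N) :
    ∫⁻ x in A, ENNReal.ofReal (Ftil Ω x y) *
        ENNReal.ofReal (phiw Ω {(0 : Euc N)} (((N : ℝ) - 2) / 2) x) ≤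
      ENNReal.ofReal (6 * (N + 1)) *
        (2 * ((∫⁻ x in ball (0 : Euc N) 1,
          ENNReal.ofReal (dist x 0 ^ (-((N : ℝ) - 3 / 2)))) + volume Ω)) ^ ((N : ℝ) / (N + 1)) *
        (∫⁻ x in A, ENNReal.ofReal (phiw Ω {(0 : Euc N)} (((N : ℝ) - 2) / 2) x)) ^
          (1 / ((N : ℝ) + 1)) := by
  have hN' : (3 : ℝ) ≤ N := by exact_mod_cast hN
  set n : ℝ := (N : ℝ)
  set φ : Euc N → ℝ := phiw Ω {(0 : Euc N)} ((n - 2) / 2)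
  have hφm : Measurable φ := measurable_phiw _ _ _
  set I := ∫⁻ x in ball (0 : Euc N) 1, ENNReal.ofReal (dist x 0 ^ (-(n - 3 / 2)))
  set f : Euc N → ENNReal := fun x => ENNReal.ofReal (φ x) ^ (1 / (n + 1))
  set g : Euc N → ENNReal := fun x =>
    ENNReal.ofReal (dist x 0 ^ (-(n - 3 / 2)) + dist x y ^ (-(n - 3 / 2))) ^ (n / (n + 1))
  have hf : Measurable f := by fun_prop
  have hg : Measurable g := by fun_prop
  have hpt : ∀ x ∈ A, ENNReal.ofReal (Ftil Ω x y) * ENNReal.ofReal (φ x) ≤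
      ENNReal.ofReal (6 * (n + 1)) * (f * g) x := by
    intro x hx
    have hφ0 : 0 ≤ φ x := phiw_nonneg _ _ _ x
    rw [← ENNReal.ofReal_mul (Ftil_nonneg _ _ _)]
    refine (ENNReal.ofReal_le_ofReal (Ftil_mul_phiw_le hN Ω (hAΩ hx).2 y)).trans_eq ?_
    rw [ENNReal.ofReal_mul (by positivity), ENNReal.ofReal_mul (Real.rpow_nonneg hφ0 _),
      ← ENNReal.ofReal_rpow_of_nonneg hφ0 (by positivity),
      ← ENNReal.ofReal_rpow_of_nonneg (by positivity) (by positivity)]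
    rfl
  have hpq : (n + 1).HolderConjugate ((n + 1) / n) := by
    rw [Real.holderConjugate_iff]
    refine ⟨by linarith, ?_⟩
    field_simp
    ring
  have hfp : ∀ x, f x ^ (n + 1) = ENNReal.ofReal (φ x) := fun x => by
    rw [← ENNReal.rpow_mul, one_div_mul_cancel (by positivity), ENNReal.rpow_one]
  have hgq : ∀ x, g x ^ ((n + 1) / n) = ENNReal.ofReal (dist x 0 ^ (-(n - 3 / 2))) +
      ENNReal.ofReal (dist x y ^ (-(n - 3 / 2))) := fun x => by
    rw [← ENNReal.rpow_mul, div_mul_div_cancel₀ (by positivity), div_self (by positivity),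
      ENNReal.rpow_one, ENNReal.ofReal_add (by positivity) (by positivity)]
  have hG : ∫⁻ x in A, g x ^ ((n + 1) / n) ≤ 2 * (I + volume Ω) := by
    have hvol : volume A ≤ volume Ω := measure_mono fun x hx => (hAΩ hx).1
    have hz : ∀ z : Euc N, ∫⁻ x in A, ENNReal.ofReal (dist x z ^ (-(n - 3 / 2))) ≤
        I + volume Ω := fun z =>
      (setLIntegral_dist_rpow_le (by linarith) A z).trans (by gcongr)
    simp_rw [hgq]
    rw [lintegral_add_left (by fun_prop), two_mul]
    exact add_le_add (hz 0) (hz y)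
  calc ∫⁻ x in A, ENNReal.ofReal (Ftil Ω x y) * ENNReal.ofReal (φ x)
      ≤ ∫⁻ x in A, ENNReal.ofReal (6 * (n + 1)) * (f * g) x := setLIntegral_mono' hA hpt
    _ = ENNReal.ofReal (6 * (n + 1)) * ∫⁻ x in A, (f * g) x :=
        lintegral_const_mul _ (hf.mul hg)
    _ ≤ ENNReal.ofReal (6 * (n + 1)) * ((∫⁻ x in A, f x ^ (n + 1)) ^ (1 / (n + 1)) *
        (∫⁻ x in A, g x ^ ((n + 1) / n)) ^ (1 / ((n + 1) / n))) := by
        gcongr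
        exact ENNReal.lintegral_mul_le_Lp_mul_Lq _ hpq hf.aemeasurable hg.aemeasurable
    _ ≤ ENNReal.ofReal (6 * (n + 1)) * ((∫⁻ x in A, ENNReal.ofReal (φ x)) ^ (1 / (n + 1)) *
        (2 * (I + volume Ω)) ^ (n / (n + 1))) := by
        simp_rw [hfp]
        rw [one_div_div]
        gcongr
    _ = _ := by ring

/-- the weak `L^{(N+1)/N}(Ω∖{0}; φ)` estimate of `𝔽̃[φ τ]`, where
`φ(x) = |x|^{−(N−2)/2} d(x)`. -/
theorem weak_estimate_Ftilde
    (N : ℕ) (hN : 3 ≤ N)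
    (Ω : Set (Euc N)) (hΩo : IsOpen Ω) (hΩb : Bornology.IsBounded Ω)
    (h0 : (0 : Euc N) ∈ Ω) :
    ∃ C : ℝ, 0 < C ∧
      ∀ τ : Measure (Euc N),
        (∫⁻ y in Ω \ {(0 : Euc N)},
            ENNReal.ofReal (phiw Ω {(0 : Euc N)} (((N : ℝ) - 2) / 2) y) ∂τ) < ⊤ →
        ∀ A : Set (Euc N), MeasurableSet A → A ⊆ Ω \ {(0 : Euc N)} →
          0 < ∫⁻ x in A, ENNReal.ofReal (phiw Ω {(0 : Euc N)} (((N : ℝ) - 2) / 2) x) →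
          (∫⁻ x in A, ENNReal.ofReal (phiw Ω {(0 : Euc N)} (((N : ℝ) - 2) / 2) x)) < ⊤ →
          ∫⁻ x in A,
              (∫⁻ y in Ω \ {(0 : Euc N)},
                ENNReal.ofReal (Ftil Ω x y *
                  phiw Ω {(0 : Euc N)} (((N : ℝ) - 2) / 2) y) ∂τ) *
                ENNReal.ofReal (phiw Ω {(0 : Euc N)} (((N : ℝ) - 2) / 2) x)
            ≤ ENNReal.ofReal C *
                (∫⁻ y in Ω \ {(0 : Euc N)},
                  ENNReal.ofReal (phiw Ω {(0 : Euc N)} (((N : ℝ) - 2) / 2) y) ∂τ) *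
                (∫⁻ x in A,
                  ENNReal.ofReal (phiw Ω {(0 : Euc N)} (((N : ℝ) - 2) / 2) x)) ^
                  (1 - (N : ℝ) / ((N : ℝ) + 1)) := by
  have hN' : (3 : ℝ) ≤ N := by exact_mod_cast hN
  have hI : ∫⁻ x in ball (0 : Euc N) 1, ENNReal.ofReal (dist x 0 ^ (-((N : ℝ) - 3 / 2))) ≠ ⊤ :=
    (lintegral_ball_dist_rpow_lt_top (by lia) (by linarith)).ne
  obtain ⟨K, hKtop, hK⟩ : ∃ K : ENNReal, K ≠ ⊤ ∧ ∀ A : Set (Euc N), MeasurableSet A →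
      A ⊆ Ω \ {(0 : Euc N)} → ∀ y, ∫⁻ x in A, ENNReal.ofReal (Ftil Ω x y) *
          ENNReal.ofReal (phiw Ω {(0 : Euc N)} (((N : ℝ) - 2) / 2) x) ≤
        K * (∫⁻ x in A, ENNReal.ofReal (phiw Ω {(0 : Euc N)} (((N : ℝ) - 2) / 2) x)) ^
          (1 / ((N : ℝ) + 1)) := by
    refine ⟨_, ?_, fun A hA hAΩ y => setLIntegral_Ftil_mul_phiw_le hN Ω hA hAΩ y⟩
    exact ENNReal.mul_ne_top ENNReal.ofReal_ne_top (ENNReal.rpow_ne_top_of_nonneg (by positivity)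
      (ENNReal.mul_ne_top (by simp) (ENNReal.add_ne_top.2 ⟨hI, hΩb.measure_lt_top.ne⟩)))
  have hKC : K ≤ ENNReal.ofReal (K.toReal + 1) := by
    rw [ENNReal.le_ofReal_iff_toReal_le hKtop (by positivity)]
    linarith
  refine ⟨K.toReal + 1, by positivity, fun τ hτ A hA hAΩ _ _ => ?_⟩
  have hexp : 1 - (N : ℝ) / (N + 1) = 1 / (N + 1) := by
    field_simp
    ring
  have hφ := (measurable_phiw Ω {(0 : Euc N)} (((N : ℝ) - 2) / 2)).ennreal_ofReal
  simp_rw [ENNReal.ofReal_mul (Ftil_nonneg Ω _ _)]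
  rw [hexp]
  refine (lintegral_lintegral_mul_mul_le (measurable_Ftil Ω).ennreal_ofReal hφ hτ.ne hφ
    (hK A hA hAΩ)).trans ?_
  rw [mul_right_comm]
  gcongr
end
end

section
/- Let Σ = {0} and α = (N−2)/2, let 0 ≤ γ ≤ 1, and let 0 < ε < (N+2)/(N−2+2γ) − 1. Then there exists a constant C > 0, depending only on N, Ω, γ, ε, such that ‖ℍ_{(N−2)/2, N, γ}[δ₀]‖_{L^{(N+2)/(N−2+2γ) − ε}_w(Ω∖{0}; φ_{(N−2)/2})} ≤ C, where δ₀ is the Dirac measure concentrated at 0. -/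
open MeasureTheory Metric Set

noncomputable section

/-- The kernel `H_{α,θ,γ}(x,y) = d(x)^{1−γ} |x|^{−α−γ} |x−y|^{−N+θ}` (case `Σ = {0}`). -/
def Hker {N : ℕ} (Ω Sg : Set (Euc N)) (α θ γ : ℝ) (x y : Euc N) : ℝ :=
  bdist Ω x ^ (1 - γ) * sdist Sg x ^ (-α - γ) * dist x y ^ (-(N : ℝ) + θ)

open scoped ENNReal in
/-- Hölder's inequality on a set `A`, with respect to the weight `w`. -/
lemma setLIntegral_mul_weight_le_Lp_mul {X : Type*} [MeasurableSpace X] {μ : Measure X}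
    {p q : ℝ} (hpq : p.HolderConjugate q) {f w : X → ℝ≥0∞} (hf : Measurable f)
    (hw : Measurable w) (A : Set X) :
    ∫⁻ x in A, f x * w x ∂μ ≤
      (∫⁻ x in A, f x ^ p * w x ∂μ) ^ (1 / p) * (∫⁻ x in A, w x ∂μ) ^ (1 / q) := by
  have h := ENNReal.lintegral_mul_le_Lp_mul_Lq ((μ.restrict A).withDensity w) hpq
    hf.aemeasurable (aemeasurable_const (b := (1 : ℝ≥0∞)))
  rw [lintegral_withDensity_eq_lintegral_mul _ hw (hf.mul measurable_const),
    lintegral_withDensity_eq_lintegral_mul _ hw (hf.pow_const p),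
    lintegral_withDensity_eq_lintegral_mul _ hw measurable_const] at h
  simpa [mul_comm] using h

/-- A function bounded by a multiple of `‖x‖ ^ (-s)` with `s < N` has finite integral on bounded
sets. -/
lemma setLIntegral_ofReal_lt_top_of_le_norm_rpow {N : ℕ} (hN : 1 ≤ N) {Ω : Set (Euc N)}
    (hΩ : Bornology.IsBounded Ω) {g : Euc N → ℝ} {K s : ℝ} (hs : s < N)
    (hle : ∀ x ∈ Ω, x ≠ 0 → g x ≤ K * ‖x‖ ^ (-s)) :
    ∫⁻ x in Ω, ENNReal.ofReal (g x) < ⊤ := by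
  obtain ⟨r, hr⟩ := hΩ.subset_ball (0 : Euc N)
  have hint : IntegrableOn (fun x : Euc N => K * ‖x‖ ^ (-s)) (ball 0 r) := by
    refine integrableOn_ball_of_norm_le_rpow (C := |K|) (α := s) (μ := volume) (by simpa using hN)
      (by simpa using hs) (ae_of_all _ fun x => ?_)
      (by fun_prop : Measurable _).aestronglyMeasurable
    rw [norm_mul, Real.norm_eq_abs, Real.norm_of_nonneg (by positivity)]
  have hne : ∀ᵐ x : Euc N, x ≠ 0 := by
    have : Nonempty (Fin N) := ⟨⟨0, hN⟩⟩
    exact Measure.ae_ne volume 0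
  calc ∫⁻ x in Ω, ENNReal.ofReal (g x)
      ≤ ∫⁻ x in Ω, ENNReal.ofReal (K * ‖x‖ ^ (-s)) := by
        refine setLIntegral_mono_ae (by fun_prop) ?_
        filter_upwards [hne] with x hx hxΩ using ENNReal.ofReal_le_ofReal (hle x hxΩ hx)
    _ ≤ ∫⁻ x in ball 0 r, ENNReal.ofReal (K * ‖x‖ ^ (-s)) := lintegral_mono_set hr
    _ < ⊤ := hint.lintegral_lt_top

lemma measurable_bdist {N : ℕ} (Ω : Set (Euc N)) : Measurable (bdist Ω) :=
  (continuous_infDist_pt _).measurable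

lemma bdist_nonneg {N : ℕ} (Ω : Set (Euc N)) (x : Euc N) : 0 ≤ bdist Ω x := infDist_nonneg

lemma exists_bdist_le {N : ℕ} {Ω : Set (Euc N)} (hΩ : Bornology.IsBounded Ω) :
    ∃ M, ∀ x ∈ Ω, bdist Ω x ≤ M := by
  obtain ⟨r, hr⟩ := hΩ.subset_closedBall (0 : Euc N)
  exact ⟨bdist Ω 0 + r, fun x hx =>
    infDist_le_infDist_add_dist.trans (add_le_add_right (hr hx) _)⟩

lemma phiw_zero_singleton {N : ℕ} (Ω : Set (Euc N)) (α : ℝ) (x : Euc N) :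
    phiw Ω {0} α x = ‖x‖ ^ (-α) * bdist Ω x := by
  simp [phiw, sdist]

lemma Hker_zero_singleton {N : ℕ} (Ω : Set (Euc N)) (α γ : ℝ) (x : Euc N) :
    Hker Ω {0} α N γ x 0 = bdist Ω x ^ (1 - γ) * ‖x‖ ^ (-α - γ) := by
  simp [Hker, sdist]

lemma measurable_phiw_zero_singleton {N : ℕ} (Ω : Set (Euc N)) (α : ℝ) :
    Measurable (phiw Ω {0} α) := by
  have := measurable_bdist Ω
  rw [funext (phiw_zero_singleton Ω α)]
  fun_prop

lemma measurable_Hker_zero_singleton {N : ℕ} (Ω : Set (Euc N)) (α γ : ℝ) :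
    Measurable fun x => Hker Ω {0} α N γ x 0 := by
  have := measurable_bdist Ω
  rw [funext (Hker_zero_singleton Ω α γ)]
  fun_prop

/-- `ℍ_{α,N,γ}[δ₀]` belongs to `L^p(Ω; φ_α)` as soon as `(α + γ) p + α < N`. -/
lemma setLIntegral_Hker_rpow_mul_phiw_lt_top {N : ℕ} (hN : 1 ≤ N) {Ω : Set (Euc N)}
    (hΩ : Bornology.IsBounded Ω) {α γ p : ℝ} (hγ : γ ≤ 1) (hp : 0 ≤ p)
    (hαp : (α + γ) * p + α < N) :
    ∫⁻ x in Ω, ENNReal.ofReal (Hker Ω {0} α N γ x 0) ^ p * ENNReal.ofReal (phiw Ω {0} α x)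
      < ⊤ := by
  obtain ⟨M, hM⟩ := exists_bdist_le hΩ
  have hH0 (x : Euc N) : 0 ≤ Hker Ω {0} α N γ x 0 := by
    have := bdist_nonneg Ω x
    rw [Hker_zero_singleton]
    positivity
  simp_rw [fun x => ENNReal.ofReal_rpow_of_nonneg (hH0 x) hp,
    fun x => (ENNReal.ofReal_mul (q := phiw Ω {0} α x) (Real.rpow_nonneg (hH0 x) p)).symm]
  refine setLIntegral_ofReal_lt_top_of_le_norm_rpow hN hΩ (K := (M ^ (1 - γ)) ^ p * M) hαp
    fun x hx hx0 => ?_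
  have hd := bdist_nonneg Ω x
  have hdM := hM x hx
  have hMnn := hd.trans hdM
  have hxpos : 0 < ‖x‖ := norm_pos_iff.mpr hx0
  rw [Hker_zero_singleton, phiw_zero_singleton, Real.mul_rpow (by positivity) (by positivity),
    ← Real.rpow_mul hxpos.le,
    show -((α + γ) * p + α) = (-α - γ) * p + -α by ring, Real.rpow_add hxpos]
  calc _ = (bdist Ω x ^ (1 - γ)) ^ p * bdist Ω x * (‖x‖ ^ ((-α - γ) * p) * ‖x‖ ^ (-α)) := by ring
    _ ≤ _ := by
      have h1 : 0 ≤ 1 - γ := by linarith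
      gcongr

/-- weak `L^{(N+2)/(N−2+2γ) − ε}(Ω∖{0}; φ_{(N−2)/2})` estimate for
`ℍ_{(N−2)/2, N, γ}[δ₀]`, where `δ₀` is the Dirac mass at the origin. -/
theorem weak_estimate_H_dirac_critical
    (N : ℕ) (hN : 3 ≤ N)
    (Ω : Set (Euc N)) (hΩo : IsOpen Ω) (hΩb : Bornology.IsBounded Ω)
    (h0 : (0 : Euc N) ∈ Ω)
    (γ : ℝ) (hγ0 : 0 ≤ γ) (hγ1 : γ ≤ 1)
    (ε : ℝ) (hε0 : 0 < ε) (hε1 : ε < ((N : ℝ) + 2) / ((N : ℝ) - 2 + 2 * γ) - 1) :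
    ∃ C : ℝ, 0 < C ∧
      ∀ A : Set (Euc N), MeasurableSet A → A ⊆ Ω \ {(0 : Euc N)} →
        0 < ∫⁻ x in A, ENNReal.ofReal (phiw Ω {(0 : Euc N)} (((N : ℝ) - 2) / 2) x) →
        (∫⁻ x in A, ENNReal.ofReal (phiw Ω {(0 : Euc N)} (((N : ℝ) - 2) / 2) x)) < ⊤ →
        ∫⁻ x in A,
            (∫⁻ y, ENNReal.ofReal
                (Hker Ω {(0 : Euc N)} (((N : ℝ) - 2) / 2) (N : ℝ) γ x y)
              ∂(Measure.dirac (0 : Euc N))) *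
              ENNReal.ofReal (phiw Ω {(0 : Euc N)} (((N : ℝ) - 2) / 2) x)
          ≤ ENNReal.ofReal C *
              (∫⁻ x in A,
                ENNReal.ofReal (phiw Ω {(0 : Euc N)} (((N : ℝ) - 2) / 2) x)) ^
                (1 - 1 / (((N : ℝ) + 2) / ((N : ℝ) - 2 + 2 * γ) - ε)) := by
  set κ : ℝ := ((N : ℝ) + 2) / ((N : ℝ) - 2 + 2 * γ) - ε with hκ
  set α : ℝ := ((N : ℝ) - 2) / 2 with hα
  have hN3 : (3 : ℝ) ≤ N := by exact_mod_cast hN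
  have hκ1 : 1 < κ := by linarith
  have hden : 0 < (N : ℝ) - 2 + 2 * γ := by linarith
  have hexp : (α + γ) * κ + α < N := by
    have h : κ * ((N : ℝ) - 2 + 2 * γ) = N + 2 - ε * ((N : ℝ) - 2 + 2 * γ) := by
      rw [hκ, sub_mul, div_mul_cancel₀ _ hden.ne']
    have := mul_pos hε0 hden
    rw [hα]
    linarith
  have hI := setLIntegral_Hker_rpow_mul_phiw_lt_top (by omega : 1 ≤ N) hΩb hγ1
    (by linarith : 0 ≤ κ) hexp
  have hJ := ENNReal.rpow_lt_top_of_nonneg (by positivity : 0 ≤ 1 / κ) hI.ne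
  refine ⟨((∫⁻ x in Ω, ENNReal.ofReal (Hker Ω {0} α N γ x 0) ^ κ *
      ENNReal.ofReal (phiw Ω {0} α x)) ^ (1 / κ)).toReal + 1,
    add_pos_of_nonneg_of_pos ENNReal.toReal_nonneg one_pos, fun A _ hA _ _ => ?_⟩
  have hq := Real.HolderConjugate.conjExponent hκ1
  have hq' : 1 - 1 / κ = 1 / κ.conjExponent := by
    simpa using hq.one_sub_inv
  simp only [lintegral_dirac]
  rw [hq']
  refine (setLIntegral_mul_weight_le_Lp_mul hq
    (measurable_Hker_zero_singleton Ω α γ).ennreal_ofReal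
    (measurable_phiw_zero_singleton Ω α).ennreal_ofReal A).trans ?_
  gcongr
  calc _ ≤ (∫⁻ x in Ω, ENNReal.ofReal (Hker Ω {0} α N γ x 0) ^ κ *
        ENNReal.ofReal (phiw Ω {0} α x)) ^ (1 / κ) := by
        gcongr
        exact hA.trans sdiff_subset
    _ ≤ _ := by
        rw [← ENNReal.ofReal_toReal hJ.ne]
        exact ENNReal.ofReal_le_ofReal (by simp)
end
end

section
/- Let p, q > 0 and let g : ℝ × [0,∞) → [0,∞) be nondecreasing in each of its two variables and locally Lipschitz, with g(0,0) = 0 and ∫₁^∞ s^{−p−1} g(s, s^{p/q}) ds < ∞. Let u : X → ℝ and v : X → [0,∞) be measurable, and suppose there exist constants C_u, C_v > 0 such that e_u(s) ≤ C_u s^{−p} and e_v(s) ≤ C_v s^{−q} for all s > 0. Then for every s₀ > 0 one has ∫_X g(u, v) dω ≤ ∫_{E_u(s₀)ᶜ ∩ E_v(s₀^{p/q})ᶜ} g(u, v) dω + 2p(C_u + C_v) ∫_{s₀}^∞ g(s, s^{p/q}) s^{−1−p} ds. -/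
open MeasureTheory Set

noncomputable section

/-- If the tails of `ν` beyond `a` are dominated by those of `m` for all `a ≥ s₀`, then so are
the integrals over `(s₀, ∞)` of nonnegative continuous functions that are nondecreasing there. -/
lemma setLIntegral_Ioi_le_of_tail_le {ν m : Measure ℝ} {G : ℝ → ℝ} {s₀ : ℝ}
    (hG : Continuous G) (hG_nonneg : ∀ s, 0 ≤ G s) (hG_mono : MonotoneOn G (Ioi s₀))
    (h : ∀ a, s₀ ≤ a → ν (Ioi a) ≤ m (Ioi a)) :
    ∫⁻ s in Ioi s₀, ENNReal.ofReal (G s) ∂ν ≤ ∫⁻ s in Ioi s₀, ENNReal.ofReal (G s) ∂m := by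
  rw [lintegral_eq_lintegral_meas_lt _ (ae_of_all _ hG_nonneg) hG.measurable.aemeasurable,
    lintegral_eq_lintegral_meas_lt _ (ae_of_all _ hG_nonneg) hG.measurable.aemeasurable]
  refine lintegral_mono fun t => ?_
  have hopen : IsOpen {s | t < G s} := isOpen_lt continuous_const hG
  simp only [Measure.restrict_apply hopen.measurableSet]
  set S := {s | t < G s} ∩ Ioi s₀ with hS
  have hSo : IsOpen S := hopen.inter isOpen_Ioi
  rcases S.eq_empty_or_nonempty with hempty | hne
  · simp [hempty]
  have hlow : s₀ ∈ lowerBounds S := fun s hs => hs.2.le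
  have hbdd : BddBelow S := ⟨s₀, hlow⟩
  have hle : s₀ ≤ sInf S := le_csInf hne hlow
  have hSeq : S = Ioi (sInf S) := by
    ext s
    constructor
    · intro hs
      refine lt_of_le_of_ne (csInf_le hbdd hs) fun heq => ?_
      obtain ⟨b, hb, hbS⟩ := exists_Ioc_subset_of_mem_nhds (hSo.mem_nhds hs) ⟨s - 1, by simp⟩
      have hmem : (b + s) / 2 ∈ S := hbS ⟨by linarith, by linarith⟩
      have := csInf_le hbdd hmem
      linarith
    · intro hs
      obtain ⟨b, hb, hbs⟩ := exists_lt_of_csInf_lt hne hs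
      have hs' : s₀ < s := hle.trans_lt hs
      exact ⟨lt_of_lt_of_le hb.1 (hG_mono hb.2 hs' hbs.le), hs'⟩
  rw [hSeq]
  exact h _ hle

/-- The tail of the measure with density `p C s ^ (-1 - p)` is `C a ^ (-p)`. -/
lemma setLIntegral_Ioi_ofReal_rpow {p C a : ℝ} (hp : 0 < p) (hC : 0 ≤ C) (ha : 0 < a) :
    ∫⁻ s in Ioi a, ENNReal.ofReal (p * C * s ^ (-1 - p)) = ENNReal.ofReal (C * a ^ (-p)) := by
  have hint : IntegrableOn (fun s : ℝ => p * C * s ^ (-1 - p)) (Ioi a) :=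
    (integrableOn_Ioi_rpow_of_lt (by linarith) ha).const_mul _
  rw [← ofReal_integral_eq_lintegral_ofReal hint, integral_const_mul,
    integral_Ioi_rpow_of_lt (by linarith) ha]
  · congr 1
    have : -1 - p + 1 = -p := by ring
    rw [this]
    field_simp
  · filter_upwards [ae_restrict_mem measurableSet_Ioi] with s hs
    have : 0 < s := ha.trans hs
    simp only [Pi.zero_apply]
    positivity

/-- Let `g : ℝ × ℝ₊ → ℝ₊` be nondecreasing in each variable and locally
Lipschitz, with `g(0,0) = 0` and `∫₁^∞ s^{−p−1} g(s, s^{p/q}) ds < ∞`.  If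
`ω({|u| > s}) ≤ Cu s^{−p}` and `ω({|v| > s}) ≤ Cv s^{−q}` for all `s > 0`, then for every
`s₀ > 0`,
`∫ g(u,v) dω ≤ ∫_{E_u(s₀)ᶜ ∩ E_v(s₀^{p/q})ᶜ} g(u,v) dω
  + 2p(Cu+Cv) ∫_{s₀}^∞ g(s, s^{p/q}) s^{−1−p} ds`. -/
theorem uniform_integrability_lemma
    {X : Type*} [MeasurableSpace X] (ω : Measure X)
    (p q : ℝ) (hp : 0 < p) (hq : 0 < q)
    (g : ℝ → ℝ → ℝ)
    (hg_nonneg : ∀ s t, 0 ≤ g s t)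
    (hg_mono : ∀ s₁ s₂ t₁ t₂, s₁ ≤ s₂ → t₁ ≤ t₂ → g s₁ t₁ ≤ g s₂ t₂)
    (hg_lip : LocallyLipschitz (fun st : ℝ × ℝ => g st.1 st.2))
    (hg00 : g 0 0 = 0)
    (hg_int : IntegrableOn (fun s : ℝ => s ^ (-p - 1) * g s (s ^ (p / q))) (Set.Ioi 1))
    (u : X → ℝ) (v : X → ℝ) (hv0 : ∀ x, 0 ≤ v x)
    (hu_meas : Measurable u) (hv_meas : Measurable v)
    (Cu Cv : ℝ) (hCu : 0 < Cu) (hCv : 0 < Cv)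
    (hu : ∀ s : ℝ, 0 < s → ω {x | s < |u x|} ≤ ENNReal.ofReal (Cu * s ^ (-p)))
    (hv : ∀ s : ℝ, 0 < s → ω {x | s < |v x|} ≤ ENNReal.ofReal (Cv * s ^ (-q)))
    (s₀ : ℝ) (hs₀ : 0 < s₀) :
    ∫⁻ x, ENNReal.ofReal (g (u x) (v x)) ∂ω ≤
      (∫⁻ x in {x | |u x| ≤ s₀} ∩ {x | |v x| ≤ s₀ ^ (p / q)},
          ENNReal.ofReal (g (u x) (v x)) ∂ω) +
        ENNReal.ofReal
          (2 * p * (Cu + Cv) *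
            ∫ s in Set.Ioi s₀, g s (s ^ (p / q)) * s ^ (-1 - p)) := by
  set G : ℝ → ℝ := fun s => g s (s ^ (p / q)) with hGdef
  set C := Cu + Cv with hCdef
  have hC : 0 < C := add_pos hCu hCv
  have hpq : 0 < p / q := div_pos hp hq
  have hqp : 0 < q / p := div_pos hq hp
  have hG : Continuous G :=
    hg_lip.continuous.comp (continuous_id.prodMk (Real.continuous_rpow_const hpq.le))
  have hG_mono : MonotoneOn G (Ioi s₀) := fun a ha b _ hab =>
    hg_mono _ _ _ _ hab (Real.rpow_le_rpow (hs₀.trans ha).le hab hpq.le)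
  have hroot : ∀ t s : ℝ, 0 ≤ t → 0 ≤ s → (t ^ (q / p) ≤ s ↔ t ≤ s ^ (p / q)) := by
    intro t s ht hs
    have := Real.rpow_le_rpow_iff (Real.rpow_nonneg ht (q / p)) hs hpq
    rw [← Real.rpow_mul ht, div_mul_div_cancel₀ hp.ne', div_self hq.ne', Real.rpow_one] at this
    exact this.symm
  set w : X → ℝ := fun x => max |u x| (v x ^ (q / p)) with hw
  have hw_meas : Measurable w := by
    have : Measurable fun x => |u x| := hu_meas.abs
    exact this.max (hv_meas.pow_const _)
  have hw0 : ∀ x, 0 ≤ w x := fun x => (abs_nonneg _).trans (le_max_left _ _)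
  have hgw : ∀ x, g (u x) (v x) ≤ G (w x) := fun x =>
    hg_mono _ _ _ _ ((le_abs_self _).trans (le_max_left _ _))
      ((hroot _ _ (hv0 x) (hw0 x)).1 (le_max_right _ _))
  have hset : ∀ s : ℝ, 0 ≤ s →
      {x | |u x| ≤ s} ∩ {x | |v x| ≤ s ^ (p / q)} = {x | w x ≤ s} := by
    intro s hs
    ext x
    simp only [mem_inter_iff, mem_ofPred_eq, hw, max_le_iff, abs_of_nonneg (hv0 x),
      hroot _ _ (hv0 x) hs]
  have htail : ∀ s : ℝ, 0 < s → ω {x | s < w x} ≤ ENNReal.ofReal (C * s ^ (-p)) := by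
    intro s hs
    have hsub : {x | s < w x} ⊆ {x | s < |u x|} ∪ {x | s ^ (p / q) < |v x|} := by
      intro x hx
      by_contra hcon
      simp only [mem_union, mem_ofPred_eq, not_or, not_lt] at hcon
      have : x ∈ {x | w x ≤ s} := hset s hs.le ▸ hcon
      exact not_lt.2 (show w x ≤ s from this) hx
    have hexp : (s ^ (p / q)) ^ (-q) = s ^ (-p) := by
      rw [← Real.rpow_mul hs.le]
      congr 1
      field_simp
    calc ω {x | s < w x} ≤ ω {x | s < |u x|} + ω {x | s ^ (p / q) < |v x|} :=
          (measure_mono hsub).trans (measure_union_le _ _)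
      _ ≤ ENNReal.ofReal (Cu * s ^ (-p)) + ENNReal.ofReal (Cv * (s ^ (p / q)) ^ (-q)) :=
          add_le_add (hu s hs) (hv _ (Real.rpow_pos_of_pos hs _))
      _ = ENNReal.ofReal (C * s ^ (-p)) := by
          rw [hexp, ← ENNReal.ofReal_add (by positivity) (by positivity), ← add_mul]
  have hint : IntegrableOn (fun s => G s * s ^ (-1 - p)) (Ioi s₀) := by
    have hloc : IntegrableOn (fun s => G s * s ^ (-1 - p)) (Icc s₀ 1) := by
      refine ContinuousOn.integrableOn_Icc (hG.continuousOn.mul ?_)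
      exact continuousOn_id.rpow_const fun s hs => Or.inl (hs₀.trans_le hs.1).ne'
    have htop : IntegrableOn (fun s => G s * s ^ (-1 - p)) (Ioi 1) := by
      refine hg_int.congr_fun (fun s _ => ?_) measurableSet_Ioi
      simp only [hGdef]
      rw [mul_comm, neg_sub_comm]
    refine (hloc.union htop).mono_set fun s hs => ?_
    rcases le_or_gt s 1 with h1 | h1
    · exact Or.inl ⟨le_of_lt hs, h1⟩
    · exact Or.inr h1
  have hdens : Measurable fun s : ℝ => ENNReal.ofReal (p * C * s ^ (-1 - p)) := by fun_prop
  have hcompare := setLIntegral_Ioi_le_of_tail_le (ν := ω.map w)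
    (m := volume.withDensity fun s : ℝ => ENNReal.ofReal (p * C * s ^ (-1 - p)))
    hG (fun s => hg_nonneg _ _) hG_mono (by
      intro a ha
      have ha0 := hs₀.trans_le ha
      rw [Measure.map_apply hw_meas measurableSet_Ioi, withDensity_apply _ measurableSet_Ioi,
        setLIntegral_Ioi_ofReal_rpow hp hC.le ha0]
      exact htail a ha0)
  have hGm : Measurable fun s => ENNReal.ofReal (G s) := hG.measurable.ennreal_ofReal
  rw [setLIntegral_map measurableSet_Ioi hGm hw_meas,
    setLIntegral_withDensity_eq_setLIntegral_mul _ hdens hGm measurableSet_Ioi] at hcompare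
  have hA : MeasurableSet {x | w x ≤ s₀} := measurableSet_le hw_meas measurable_const
  have hAc : {x | w x ≤ s₀}ᶜ = w ⁻¹' Ioi s₀ := by
    ext x
    simp
  have hI : 0 ≤ ∫ s in Ioi s₀, G s * s ^ (-1 - p) :=
    setIntegral_nonneg measurableSet_Ioi fun s hs =>
      mul_nonneg (hg_nonneg _ _) (Real.rpow_nonneg (hs₀.trans hs).le _)
  rw [hset s₀ hs₀.le, ← lintegral_add_compl _ hA, hAc]
  gcongr
  calc ∫⁻ x in w ⁻¹' Ioi s₀, ENNReal.ofReal (g (u x) (v x)) ∂ω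
      ≤ ∫⁻ x in w ⁻¹' Ioi s₀, ENNReal.ofReal (G (w x)) ∂ω :=
        lintegral_mono fun x => ENNReal.ofReal_le_ofReal (hgw x)
    _ ≤ _ := hcompare
    _ = ∫⁻ s in Ioi s₀, ENNReal.ofReal (p * C * (G s * s ^ (-1 - p))) := by
        refine setLIntegral_congr_fun measurableSet_Ioi fun s hs => ?_
        have hs0 : 0 < s := hs₀.trans hs
        simp only [Pi.mul_apply]
        rw [← ENNReal.ofReal_mul (by positivity)]
        congr 1
        ring
    _ = ENNReal.ofReal (p * C * ∫ s in Ioi s₀, G s * s ^ (-1 - p)) := by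
        rw [← ofReal_integral_eq_lintegral_ofReal (hint.const_mul _), integral_const_mul]
        filter_upwards [ae_restrict_mem measurableSet_Ioi] with s hs
        exact mul_nonneg (by positivity)
          (mul_nonneg (hg_nonneg _ _) (Real.rpow_nonneg (hs₀.trans hs).le _))
    _ ≤ ENNReal.ofReal (2 * p * C * ∫ s in Ioi s₀, G s * s ^ (-1 - p)) := by
        refine ENNReal.ofReal_le_ofReal (mul_le_mul_of_nonneg_right ?_ hI)
        nlinarith [mul_pos hp hC]
end
end

section
/- Let α ≤ N−1. There exists a constant C > 0, depending only on N, Ω, Σ and α, such that for all x, y, z in the closure of Ω one has 𝒩_{α,1}(x,y)^{−1} ≤ C ( 𝒩_{α,1}(x,z)^{−1} + 𝒩_{α,1}(z,y)^{−1} ), with the convention 𝒩_{α,1}(x,x)^{−1} = 0. -/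
open MeasureTheory Metric Set

noncomputable section

/-- The kernel `𝒩_{α,1}(x,y)`. -/
def Nker {N : ℕ} (Ω Sg : Set (Euc N)) (α : ℝ) (x y : Euc N) : ℝ :=
  max (dist x y) (max (sdist Sg x) (sdist Sg y)) ^ α /
    (dist x y ^ ((N : ℝ) - 1) * max (dist x y) (max (bdist Ω x) (bdist Ω y)))

theorem rpow_mul_rpow_neg_le {p α r a M M' : ℝ} (hp : 0 ≤ p) (hα : α ≤ p) (hr : 0 < r)
    (ha : 0 < a) (hM : 0 < M) (hM' : 0 < M') (hra : r ≤ 3 * a) (hMM : M ≤ 3 * M')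
    (hrM : r * M' ≤ 3 * a * M) :
    r ^ p * M ^ (-α) ≤ 3 ^ (p + |α|) * (a ^ p * M' ^ (-α)) := by
  rcases le_total α 0 with h | h
  · calc r ^ p * M ^ (-α) ≤ (3 * a) ^ p * (3 * M') ^ (-α) :=
          mul_le_mul (Real.rpow_le_rpow hr.le hra hp)
            (Real.rpow_le_rpow hM.le hMM (by linarith)) (by positivity) (by positivity)
      _ = 3 ^ (p + |α|) * (a ^ p * M' ^ (-α)) := by
          rw [abs_of_nonpos h, Real.rpow_add (by norm_num), Real.mul_rpow (by norm_num) ha.le,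
            Real.mul_rpow (by norm_num) hM'.le]
          ring
  · have hq : r / M ≤ 3 * a / M' := by
      rw [div_le_div_iff₀ hM hM']
      exact hrM
    have split : ∀ u v : ℝ, 0 < u → 0 < v → u ^ p * v ^ (-α) = u ^ (p - α) * (u / v) ^ α := by
      intro u v hu hv
      rw [Real.div_rpow hu.le hv.le, Real.rpow_neg hv.le, Real.rpow_sub hu]
      have := (Real.rpow_pos_of_pos hu α).ne'
      field_simp
    calc r ^ p * M ^ (-α) = r ^ (p - α) * (r / M) ^ α := split r M hr hM
      _ ≤ (3 * a) ^ (p - α) * (3 * a / M') ^ α :=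
          mul_le_mul (Real.rpow_le_rpow hr.le hra (by linarith))
            (Real.rpow_le_rpow (by positivity) hq h) (by positivity) (by positivity)
      _ = 3 ^ p * (a ^ p * M' ^ (-α)) := by
          rw [← split (3 * a) M' (by positivity) hM', Real.mul_rpow (by norm_num) ha.le]
          ring
      _ ≤ 3 ^ (p + |α|) * (a ^ p * M' ^ (-α)) := by
          gcongr
          · norm_num
          · linarith [abs_nonneg α]

theorem max_le_three_mul_max {r a s t w : ℝ} (ha : 0 ≤ a) (har : r ≤ 2 * a)
    (hts : t ≤ s + r) : max r (max s t) ≤ 3 * max a (max s w) := by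
  have h1 : a ≤ max a (max s w) := le_max_left _ _
  have h2 : s ≤ max a (max s w) := (le_max_left _ _).trans (le_max_right _ _)
  exact max_le (by linarith) (max_le (by linarith) (by linarith))

theorem Nker_inv {N : ℕ} (Ω Sg : Set (Euc N)) (α : ℝ) (x y : Euc N) :
    (Nker Ω Sg α x y)⁻¹ =
      dist x y ^ ((N : ℝ) - 1) * max (dist x y) (max (sdist Sg x) (sdist Sg y)) ^ (-α) *
        max (dist x y) (max (bdist Ω x) (bdist Ω y)) := by
  have h : 0 ≤ max (dist x y) (max (sdist Sg x) (sdist Sg y)) := le_max_of_le_left dist_nonneg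
  rw [Nker, inv_div, Real.rpow_neg h, div_eq_mul_inv]
  ring

theorem Nker_comm {N : ℕ} (Ω Sg : Set (Euc N)) (α : ℝ) (x y : Euc N) :
    Nker Ω Sg α x y = Nker Ω Sg α y x := by
  simp only [Nker, dist_comm x y, max_comm (sdist Sg x), max_comm (bdist Ω x)]

theorem Nker_inv_nonneg {N : ℕ} (Ω Sg : Set (Euc N)) (α : ℝ) (x y : Euc N) :
    0 ≤ (Nker Ω Sg α x y)⁻¹ := by
  have h : ∀ t : ℝ, 0 ≤ max (dist x y) t := fun _ => le_max_of_le_left dist_nonneg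
  rw [Nker_inv]
  exact mul_nonneg (mul_nonneg (Real.rpow_nonneg dist_nonneg _) (Real.rpow_nonneg (h _) _)) (h _)

theorem Nker_inv_le_of_dist_le {N : ℕ} (hN : 1 ≤ N) (Ω Sg : Set (Euc N)) {α : ℝ}
    (hα : α ≤ (N : ℝ) - 1) {x y z : Euc N} (hxy : 0 < dist x y)
    (hxz : dist x y ≤ 2 * dist x z) :
    (Nker Ω Sg α x y)⁻¹ ≤ 3 * 3 ^ ((N : ℝ) - 1 + |α|) * (Nker Ω Sg α x z)⁻¹ := by
  have hp : (0 : ℝ) ≤ (N : ℝ) - 1 := by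
    have : (1 : ℝ) ≤ N := by exact_mod_cast hN
    linarith
  have lip : ∀ (S : Set (Euc N)) (w : Euc N), infDist w S ≤ infDist x S + dist x w := fun S w => by
    rw [dist_comm]
    exact infDist_le_infDist_add_dist
  have ha : 0 < dist x z := by linarith
  have hM : max (dist x y) (max (sdist Sg x) (sdist Sg y)) ≤
      3 * max (dist x z) (max (sdist Sg x) (sdist Sg z)) :=
    max_le_three_mul_max dist_nonneg hxz (lip Sg y)
  have hD : max (dist x y) (max (bdist Ω x) (bdist Ω y)) ≤
      3 * max (dist x z) (max (bdist Ω x) (bdist Ω z)) :=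
    max_le_three_mul_max dist_nonneg hxz (lip _ y)
  have hs : 0 ≤ sdist Sg x := infDist_nonneg
  have hMz : max (dist x z) (max (sdist Sg x) (sdist Sg z)) ≤ sdist Sg x + dist x z :=
    max_le (by linarith) (max_le (by linarith) (lip Sg z))
  have hrM : dist x y * max (dist x z) (max (sdist Sg x) (sdist Sg z)) ≤
      3 * dist x z * max (dist x y) (max (sdist Sg x) (sdist Sg y)) := by
    have h1 : dist x y ≤ max (dist x y) (max (sdist Sg x) (sdist Sg y)) := le_max_left _ _
    have h2 : sdist Sg x ≤ max (dist x y) (max (sdist Sg x) (sdist Sg y)) :=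
      (le_max_left _ _).trans (le_max_right _ _)
    calc _ ≤ dist x y * (sdist Sg x + dist x z) := mul_le_mul_of_nonneg_left hMz hxy.le
      _ ≤ 2 * dist x z * sdist Sg x + dist x z * dist x y := by
          linarith [mul_le_mul_of_nonneg_right hxz hs]
      _ ≤ _ := by
          linarith [mul_le_mul_of_nonneg_left h1 ha.le, mul_le_mul_of_nonneg_left h2 ha.le]
  have hMpos := lt_max_of_lt_left (c := max (sdist Sg x) (sdist Sg y)) hxy
  have hMpos' := lt_max_of_lt_left (c := max (sdist Sg x) (sdist Sg z)) ha
  have hDpos := lt_max_of_lt_left (c := max (bdist Ω x) (bdist Ω y)) hxy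
  have key := rpow_mul_rpow_neg_le hp hα hxy ha hMpos hMpos' (by linarith) hM hrM
  rw [Nker_inv, Nker_inv]
  refine (mul_le_mul key hD hDpos.le (by positivity)).trans (le_of_eq (by ring))

/-- the quasi-metric inequality for `𝒩_{α,1}⁻¹`.  (Note that in Lean
`(𝒩_{α,1}(x,x))⁻¹ = 0⁻¹ = 0`, realizing the convention of the statement.) -/
theorem quasi_metric_inequality
    (N k : ℕ) (hN : 3 ≤ N) (hk : k + 2 < N)
    (Ω Sg : Set (Euc N)) (hΩo : IsOpen Ω) (hΩb : Bornology.IsBounded Ω) (hΩne : Ω.Nonempty)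
    (hSgc : IsCompact Sg) (hSgΩ : Sg ⊆ Ω) (hSgne : Sg.Nonempty)
    (hdim : dimH Sg = k) (hk0 : k = 0 → Sg = {(0 : Euc N)})
    (α : ℝ) (hα : α ≤ (N : ℝ) - 1) :
    ∃ C : ℝ, 0 < C ∧
      ∀ x ∈ closure Ω, ∀ y ∈ closure Ω, ∀ z ∈ closure Ω,
        (Nker Ω Sg α x y)⁻¹ ≤ C * ((Nker Ω Sg α x z)⁻¹ + (Nker Ω Sg α z y)⁻¹) := by
  have hN1 : 1 ≤ N := by omega
  have hC : (0 : ℝ) < 3 * 3 ^ ((N : ℝ) - 1 + |α|) := by positivity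
  refine ⟨_, hC, fun x _ y _ z _ => ?_⟩
  have hxz := Nker_inv_nonneg Ω Sg α x z
  have hzy := Nker_inv_nonneg Ω Sg α z y
  rcases (dist_nonneg (x := x) (y := y)).eq_or_lt with h | h
  · have hN2 : (N : ℝ) - 1 ≠ 0 := by
      have : (3 : ℝ) ≤ N := by exact_mod_cast hN
      linarith
    rw [Nker_inv Ω Sg α x y, ← h, Real.zero_rpow hN2, zero_mul, zero_mul]
    exact mul_nonneg hC.le (add_nonneg hxz hzy)
  rw [mul_add]
  rcases le_total (dist z y) (dist x z) with h' | h'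
  · have := Nker_inv_le_of_dist_le hN1 Ω Sg hα h (z := z) (by linarith [dist_triangle x z y])
    linarith [mul_nonneg hC.le hzy]
  · have := Nker_inv_le_of_dist_le hN1 Ω Sg hα (x := y) (y := x) (z := z)
      (by rwa [dist_comm]) (by
        rw [dist_comm y x, dist_comm y z]
        linarith [dist_triangle x z y])
    rw [Nker_comm Ω Sg α y x, Nker_comm Ω Sg α y z] at this
    linarith [mul_nonneg hC.le hxz]
end
end

section
/- Let p, q ≥ 0 satisfy p+q > 1 and (N−2)p + Nq < N+2, and let 0 < ε < min( N−2, 2, (N+2 − (N−2)p − Nq)/(2(p+q)) ). Then there exists a constant C > 0, depending only on N, Ω, p, q, ε, such that ∫_Ω 𝒩_{N−1−ε,1}(x, 0)^{p+q} d(x)^{p+1} |x|^{−(N−2)(p+1)/2 − Nq/2} dx ≤ C; equivalently, for every Borel set E ⊂ closure(Ω), ∫_E ℕ_{N−1−ε,1}[1_E δ₀](x)^{p+q} d(x)^{p+1} |x|^{−(N−2)(p+1)/2 − Nq/2} dx ≤ C δ₀(E), where δ₀ is the Dirac measure at 0. -/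
open MeasureTheory Metric Set
open scoped ENNReal NNReal

noncomputable section

lemma integrable_indicator_ball_norm_rpow {N : ℕ} (hN : 1 ≤ N) {s R : ℝ} (hR : 0 < R)
    (hs : -(N : ℝ) < s) :
    Integrable (fun x : Euc N => (Iio R).indicator (fun r : ℝ => r ^ s) ‖x‖) := by
  have : Nonempty (Fin N) := ⟨⟨0, hN⟩⟩
  rw [integrable_fun_norm_addHaar (E := Euc N) volume
    (f := (Iio R).indicator (fun r : ℝ => r ^ s))]
  have hint : IntegrableOn (fun r : ℝ => r ^ ((N : ℝ) - 1 + s)) (Ioo 0 R) :=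
    (intervalIntegral.integrableOn_Ioo_rpow_iff hR).2 (by linarith)
  have hind := (integrable_indicator_iff measurableSet_Ioo).2 hint
  refine hind.integrableOn.congr_fun (s := Ioi 0) (fun r hr => ?_) measurableSet_Ioi
  have hr0 : (0 : ℝ) < r := hr
  by_cases hrR : r < R
  · rw [indicator_of_mem (show r ∈ Ioo 0 R from ⟨hr0, hrR⟩)]
    simp only [finrank_euclideanSpace, Fintype.card_fin, smul_eq_mul]
    rw [indicator_of_mem (show r ∈ Iio R from hrR), Real.rpow_add hr0, ← Real.rpow_natCast,
      Nat.cast_sub hN, Nat.cast_one]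
  · rw [indicator_of_notMem (fun h => hrR h.2)]
    simp only [smul_eq_mul]
    rw [indicator_of_notMem (show r ∉ Iio R from hrR), mul_zero]

lemma bdist_zero_pos {N : ℕ} (hN : 1 ≤ N) {Ω : Set (Euc N)} (hΩo : IsOpen Ω)
    (hΩb : Bornology.IsBounded Ω) (h0 : (0 : Euc N) ∈ Ω) : 0 < bdist Ω 0 := by
  have : Nonempty (Fin N) := ⟨⟨0, hN⟩⟩
  have hne : Ω ≠ univ := by
    rintro rfl
    exact NormedSpace.unbounded_univ ℝ (Euc N) hΩb
  have hfr : (frontier Ω).Nonempty := nonempty_frontier_iff.2 ⟨⟨0, h0⟩, hne⟩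
  refine (isClosed_frontier.notMem_iff_infDist_pos hfr).1 fun h => ?_
  exact h.2 (hΩo.interior_eq.symm ▸ h0)

lemma Nker_zero_le {N : ℕ} {Ω : Set (Euc N)} (hd : 0 < bdist Ω 0) (ε : ℝ) {x : Euc N}
    (hx : x ≠ 0) : Nker Ω {(0 : Euc N)} ((N : ℝ) - 1 - ε) x 0 ≤ ‖x‖ ^ (-ε) / bdist Ω 0 := by
  have hr : 0 < ‖x‖ := norm_pos_iff.2 hx
  have hN := Real.rpow_pos_of_pos hr ((N : ℝ) - 1)
  have hle : bdist Ω 0 ≤ max ‖x‖ (max (bdist Ω x) (bdist Ω 0)) :=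
    (le_max_right _ _).trans (le_max_right _ _)
  have heq : Nker Ω {(0 : Euc N)} ((N : ℝ) - 1 - ε) x 0
      = ‖x‖ ^ (-ε) / max ‖x‖ (max (bdist Ω x) (bdist Ω 0)) := by
    simp only [Nker, sdist, infDist_singleton, dist_zero_right, norm_zero]
    rw [max_eq_left hr.le, max_self, sub_eq_add_neg ((N : ℝ) - 1) ε, Real.rpow_add hr,
      mul_div_mul_left _ _ hN.ne']
  rw [heq]
  gcongr

lemma Nker_nonneg {N : ℕ} (Ω Sg : Set (Euc N)) (α : ℝ) (x y : Euc N) :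
    0 ≤ Nker Ω Sg α x y :=
  div_nonneg (Real.rpow_nonneg (dist_nonneg.trans (le_max_left _ _)) _)
    (mul_nonneg (Real.rpow_nonneg dist_nonneg _) (dist_nonneg.trans (le_max_left _ _)))

lemma lintegral_Nker_zero_lt_top {N : ℕ} (hN : 1 ≤ N)
    {Ω : Set (Euc N)} (hΩo : IsOpen Ω) (hΩb : Bornology.IsBounded Ω) (h0 : (0 : Euc N) ∈ Ω)
    {ε t p θ : ℝ} (hp : 0 ≤ p) (ht : 0 ≤ t) (hexp : -(N : ℝ) < -ε * t + θ) :
    ∫⁻ x in Ω, ENNReal.ofReal (Nker Ω {(0 : Euc N)} ((N : ℝ) - 1 - ε) x 0) ^ t *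
        ENNReal.ofReal (bdist Ω x ^ (p + 1) * sdist {(0 : Euc N)} x ^ θ) < ∞ := by
  have : Nonempty (Fin N) := ⟨⟨0, hN⟩⟩
  have hd := bdist_zero_pos hN hΩo hΩb h0
  obtain ⟨R, hR, hΩR⟩ := hΩb.subset_ball_lt 0 0
  set K : ℝ := (bdist Ω 0 + R) ^ (p + 1) / bdist Ω 0 ^ t with hK
  have hint := (integrable_indicator_ball_norm_rpow hN hR hexp).const_mul K
  refine lt_of_le_of_lt ?_ (hint.integrableOn (s := Ω)).lintegral_lt_top
  refine lintegral_mono_ae ?_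
  have hne : ∀ᵐ x : Euc N ∂(volume.restrict Ω), x ≠ 0 := Measure.ae_ne _ _
  filter_upwards [hne, ae_restrict_mem hΩo.measurableSet] with x hx hxΩ
  have hr : 0 < ‖x‖ := norm_pos_iff.2 hx
  have hxR : ‖x‖ < R := by simpa using hΩR hxΩ
  have hbd : bdist Ω x ≤ bdist Ω 0 + R := by
    have := infDist_le_infDist_add_dist (s := frontier Ω) (x := x) (y := 0)
    rw [dist_zero_right] at this
    unfold bdist
    linarith
  have hb0 : 0 ≤ bdist Ω x := infDist_nonneg
  rw [ENNReal.ofReal_rpow_of_nonneg (Nker_nonneg _ _ _ _ _) ht,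
    ← ENNReal.ofReal_mul (Real.rpow_nonneg (Nker_nonneg _ _ _ _ _) _)]
  refine ENNReal.ofReal_le_ofReal ?_
  rw [indicator_of_mem (show ‖x‖ ∈ Iio R from hxR)]
  have hs : sdist {(0 : Euc N)} x = ‖x‖ := by simp [sdist]
  rw [hs]
  calc _ ≤ (‖x‖ ^ (-ε) / bdist Ω 0) ^ t * ((bdist Ω 0 + R) ^ (p + 1) * ‖x‖ ^ θ) := by
        gcongr
        · exact Nker_nonneg _ _ _ _ _
        · exact Nker_zero_le hd ε hx
    _ = K * ‖x‖ ^ (-ε * t + θ) := by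
        rw [Real.div_rpow (Real.rpow_nonneg hr.le _) hd.le, ← Real.rpow_mul hr.le,
          Real.rpow_add hr, hK]
        ring

/-- in the critical case the integral
`∫_Ω 𝒩_{N−1−ε,1}(x,0)^{p+q} d(x)^{p+1} |x|^{−(N−2)(p+1)/2 − Nq/2} dx` is finite;
equivalently the testing inequality holds for the Dirac mass `δ₀`. -/
theorem testing_inequality_dirac_critical
    (N : ℕ) (hN : 3 ≤ N)
    (Ω : Set (Euc N)) (hΩo : IsOpen Ω) (hΩb : Bornology.IsBounded Ω)
    (h0 : (0 : Euc N) ∈ Ω)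
    (p q : ℝ) (hp : 0 ≤ p) (hq : 0 ≤ q) (hpq : 1 < p + q)
    (hsub : ((N : ℝ) - 2) * p + (N : ℝ) * q < (N : ℝ) + 2)
    (ε : ℝ) (hε0 : 0 < ε)
    (hε1 : ε < min ((N : ℝ) - 2) (min 2
      (((N : ℝ) + 2 - ((N : ℝ) - 2) * p - (N : ℝ) * q) / (2 * (p + q)))))
    (θw : ℝ) (hθw : θw = -((N : ℝ) - 2) * (p + 1) / 2 - (N : ℝ) * q / 2) :
    ∃ C : ℝ, 0 < C ∧
      (∫⁻ x in Ω,
          ENNReal.ofReal (Nker Ω {(0 : Euc N)} ((N : ℝ) - 1 - ε) x 0) ^ (p + q) *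
            ENNReal.ofReal (bdist Ω x ^ (p + 1) * sdist {(0 : Euc N)} x ^ θw)
        ≤ ENNReal.ofReal C) ∧
      ∀ En : Set (Euc N), MeasurableSet En → En ⊆ closure Ω →
        ∫⁻ x in En ∩ (Ω \ {(0 : Euc N)}),
            (∫⁻ y in En,
                ENNReal.ofReal (Nker Ω {(0 : Euc N)} ((N : ℝ) - 1 - ε) x y)
              ∂(Measure.dirac (0 : Euc N))) ^ (p + q) *
              ENNReal.ofReal (bdist Ω x ^ (p + 1) * sdist {(0 : Euc N)} x ^ θw)
          ≤ ENNReal.ofReal C * Measure.dirac (0 : Euc N) En := by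
  have hN0 : (3 : ℝ) ≤ N := by exact_mod_cast hN
  have hexp : -(N : ℝ) < -ε * (p + q) + θw := by
    have h1 := (lt_min_iff.1 (lt_min_iff.1 hε1).2).2
    rw [lt_div_iff₀ (by linarith)] at h1
    rw [hθw]
    nlinarith
  have hlt := lintegral_Nker_zero_lt_top (by omega) hΩo hΩb h0 hp
    (by linarith : (0 : ℝ) ≤ p + q) hexp
  set I := ∫⁻ x in Ω, ENNReal.ofReal (Nker Ω {(0 : Euc N)} ((N : ℝ) - 1 - ε) x 0) ^ (p + q) *
    ENNReal.ofReal (bdist Ω x ^ (p + 1) * sdist {(0 : Euc N)} x ^ θw) with hI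
  have hle : I ≤ ENNReal.ofReal (I.toReal + 1) :=
    (ENNReal.ofReal_toReal hlt.ne).symm.le.trans
      (ENNReal.ofReal_le_ofReal (by linarith))
  refine ⟨I.toReal + 1, by positivity, hle, fun En _ _ => ?_⟩
  classical
  simp only [setLIntegral_dirac]
  by_cases hE : (0 : Euc N) ∈ En
  · simp only [hE, if_true, Measure.dirac_apply_of_mem, mul_one]
    exact (lintegral_mono_set fun x hx => hx.2.1).trans hle
  · simp [hE, ENNReal.zero_rpow_of_pos (show 0 < p + q by linarith)]
end
end
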